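/- Let v₀ ∈ ℝ^n, let (d_k)_{k≥0} be probability vectors in ℝ^n, and define the R1-VI iterates v_{k+1} = T(v_k) + (γ/(1−γ)) ⟨d_k, T(v_k) − v_k⟩ 𝟙. Then for every k ≥ 0 the iterates admit the closed-form expression v_{k+1} = T^{(k+1)}(v₀) + (γ/(1−γ)) ⟨d_k, T^{(k+1)}(v₀) − T^{(k)}(v₀)⟩ 𝟙, where T^{(k)} denotes the k-fold composition of T. -/

import Mathlib

/-- The Bellman operator commutes with constant shifts up to the discount factor. -/
theorem bellman_add_const {S A : Type*} [Fintype S] [Finite A] [Nonempty A]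
    (P : S → A → S → ℝ) (hP1 : ∀ s a, ∑ s', P s a s' = 1) (c : S → A → ℝ) (γ : ℝ)
    (w : S → ℝ) (b : ℝ) (s : S) :
    ⨅ a, (c s a + γ * ∑ s', P s a s' * (w s' + b)) =
      (⨅ a, (c s a + γ * ∑ s', P s a s' * w s')) + γ * b := by
  rw [ciInf_add (Set.finite_range _).bddBelow]
  congr 1
  funext a
  simp only [mul_add, Finset.sum_add_distrib, ← Finset.sum_mul, hP1]
  ring

/-- Closed form of the R1-VI iterates:
`v (k+1) = T^(k+1)(v 0) + (γ/(1-γ)) ⟨d k, T^(k+1)(v 0) - T^(k)(v 0)⟩ 𝟙`. -/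
theorem stmt7 {S A : Type*} [Fintype S] [Nonempty S] [Fintype A] [Nonempty A]
    (P : S → A → S → ℝ)
    (hP0 : ∀ s a s', 0 ≤ P s a s')
    (hP1 : ∀ s a, ∑ s', P s a s' = 1)
    (c : S → A → ℝ) (γ : ℝ) (hγ : γ ∈ Set.Ioo (0 : ℝ) 1)
    (T : (S → ℝ) → (S → ℝ))
    (hT : ∀ v s, T v s = ⨅ a, (c s a + γ * ∑ s', P s a s' * v s'))
    (d : ℕ → S → ℝ) (hd0 : ∀ k s, 0 ≤ d k s) (hd1 : ∀ k, ∑ s, d k s = 1)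
    (v : ℕ → S → ℝ)
    (hv : ∀ k, v (k + 1) =
      fun s => T (v k) s + γ / (1 - γ) * (∑ s', d k s' * (T (v k) s' - v k s'))) :
    ∀ k, v (k + 1) = fun s => T^[k + 1] (v 0) s +
      γ / (1 - γ) * (∑ s', d k s' * (T^[k + 1] (v 0) s' - T^[k] (v 0) s')) := by
  have hγ1 : 1 - γ ≠ 0 := by linarith [hγ.2]
  have step : ∀ k b, (∀ s, v k s = T^[k] (v 0) s + b) → ∀ s, v (k + 1) s =
      T^[k + 1] (v 0) s +
        γ / (1 - γ) * (∑ s', d k s' * (T^[k + 1] (v 0) s' - T^[k] (v 0) s')) := by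
    intro k b hb s
    have hTv : ∀ s, T (v k) s = T^[k + 1] (v 0) s + γ * b := by
      intro s
      rw [Function.iterate_succ_apply', hT, hT, ← bellman_add_const P hP1]
      simp only [hb]
    have hsum : ∑ s', d k s' * (T (v k) s' - v k s') =
        (∑ s', d k s' * (T^[k + 1] (v 0) s' - T^[k] (v 0) s')) - (1 - γ) * b := by
      calc ∑ s', d k s' * (T (v k) s' - v k s')
          = ∑ s', (d k s' * (T^[k + 1] (v 0) s' - T^[k] (v 0) s') -
              d k s' * ((1 - γ) * b)) := by
            refine Finset.sum_congr rfl fun s' _ => ?_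
            rw [hTv, hb]
            ring
        _ = _ := by rw [Finset.sum_sub_distrib, ← Finset.sum_mul, hd1, one_mul]
    simp only [hv, hsum]
    rw [hTv]
    field_simp
    ring
  have shift : ∀ k, ∃ b, ∀ s, v k s = T^[k] (v 0) s + b := by
    intro k
    induction k with
    | zero => exact ⟨0, fun s => by simp⟩
    | succ k ih =>
      obtain ⟨b, hb⟩ := ih
      exact ⟨_, step k b hb⟩
  intro k
  obtain ⟨b, hb⟩ := shift k
  exact funext (step k b hb)
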